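/- Let Γ : 𝔤 = ⊕_{j∈ℚ} 𝔤_j be an e-admissible grading with e ∈ 𝔤_a such that ⊕_{j<0} 𝔤_j = (⊕_{j≤−a} 𝔤_j) ⊕ (𝔤_{b−a} + 𝔤_{−b}) for some b ∈ (0, a/2]. Then all e-admissible pairs relative to Γ are pairwise equivalent. -/

import Mathlib

open Module LieAlgebra

noncomputable section

variable {L : Type*} [LieRing L] [LieAlgebra ℂ L]

/-- The pair `(𝔪, 𝔫)` of subalgebras is `e`-admissible relative to the `ℚ`-grading
`g : ℚ → Submodule ℂ L` with `e ∈ g a` for an integer `a > 1`: `𝔪`, `𝔫` are Lie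
subalgebras, are `Γ`-graded, and conditions (A2)–(A6) of Sadaka's Definition 2.2 hold. -/
def IsAdmissiblePairQ (g : ℚ → Submodule ℂ L) (e : L) (a : ℤ)
    (m n : Submodule ℂ L) : Prop :=
  -- `𝔪` and `𝔫` are Lie subalgebras of `𝔤`
  (∀ x ∈ m, ∀ y ∈ m, ⁅x, y⁆ ∈ m) ∧
  (∀ x ∈ n, ∀ y ∈ n, ⁅x, y⁆ ∈ n) ∧
  -- (A2): `𝔪`, `𝔫` are `Γ`-graded and `𝔤_{≤ -a} ⊆ 𝔪 ⊆ 𝔫 ⊆ 𝔤_{<0}`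
  m = (⨆ j : ℚ, g j ⊓ m) ∧
  n = (⨆ j : ℚ, g j ⊓ n) ∧
  (⨆ j ≤ -(a:ℚ), g j) ≤ m ∧ m ≤ n ∧ n ≤ (⨆ j < (0:ℚ), g j) ∧
  -- (A3): `𝔪^⊥ ∩ [𝔤, e] = [𝔫, e]`
  (LinearMap.BilinForm.orthogonal (killingForm ℂ L) m ⊓ LinearMap.range (ad ℂ L e)
      = Submodule.map (ad ℂ L e) n) ∧
  -- (A4): `𝔫 ∩ 𝔤^e = 0`
  n ⊓ LinearMap.ker (ad ℂ L e) = ⊥ ∧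
  -- (A5): `[𝔫, 𝔪] ⊆ 𝔪`
  (∀ x ∈ n, ∀ y ∈ m, ⁅x, y⁆ ∈ m) ∧
  -- (A6): `dim 𝔪 + dim 𝔫 = dim 𝔤 - dim 𝔤^e`
  Module.finrank ℂ ↥m + Module.finrank ℂ ↥n
    = Module.finrank ℂ L - Module.finrank ℂ ↥(LinearMap.ker (ad ℂ L e))

/-- `g : ℚ → Submodule ℂ L` is a `ℚ`-grading of the Lie algebra `L`. -/
def IsQGrading (g : ℚ → Submodule ℂ L) : Prop :=
  DirectSum.IsInternal g ∧ ∀ i j : ℚ, ∀ x ∈ g i, ∀ y ∈ g j, ⁅x, y⁆ ∈ g (i + j)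

/-- Two `e`-admissible pairs are *comparable* if they are `e`-admissible relative to one
common grading `Γ` and one is squeezed inside the other
(`𝔪 ⊆ 𝔪′ ⊆ 𝔫′ ⊆ 𝔫` or `𝔪′ ⊆ 𝔪 ⊆ 𝔫 ⊆ 𝔫′`). -/
def ComparablePairs (e : L) (p q : Submodule ℂ L × Submodule ℂ L) : Prop :=
  ∃ (g : ℚ → Submodule ℂ L) (a : ℤ), IsQGrading g ∧ 1 < a ∧ e ∈ g (a : ℚ) ∧
    IsAdmissiblePairQ g e a p.1 p.2 ∧ IsAdmissiblePairQ g e a q.1 q.2 ∧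
    ((p.1 ≤ q.1 ∧ q.1 ≤ q.2 ∧ q.2 ≤ p.2) ∨ (q.1 ≤ p.1 ∧ p.1 ≤ p.2 ∧ p.2 ≤ q.2))

/-- Two `e`-admissible pairs are *equivalent* if they are joined by a finite chain of
`e`-admissible pairs in which consecutive pairs are comparable. -/
def EquivalentPairs (e : L) : (Submodule ℂ L × Submodule ℂ L) →
    (Submodule ℂ L × Submodule ℂ L) → Prop :=
  Relation.ReflTransGen (ComparablePairs e)


/-- The alternating form `(x, y) ↦ ⟨[e, x], y⟩` attached to an element `e` of `L`. -/
def bracketForm (e : L) : LinearMap.BilinForm ℂ L := (killingForm ℂ L) ∘ₗ (ad ℂ L e)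

/-- The orthogonal of a subspace with respect to `bracketForm e`. -/
def bracketPerp (e : L) (W : Submodule ℂ L) : Submodule ℂ L := (bracketForm e).orthogonal W

/-- A subspace is graded if it is spanned by its homogeneous parts. -/
def IsGradedSubmodule (g : ℚ → Submodule ℂ L) (W : Submodule ℂ L) : Prop :=
  W ≤ ⨆ j : ℚ, g j ⊓ W

/-- The part of degree at most `c` of a graded space. -/
def lowerPart (g : ℚ → Submodule ℂ L) (c : ℚ) : Submodule ℂ L := ⨆ j ≤ c, g j

/-- The part of negative degree of a graded space. -/
def negPart (g : ℚ → Submodule ℂ L) : Submodule ℂ L := ⨆ j < (0 : ℚ), g j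

/-- `N` is a complement of `K ⊓ T` in `T` containing `G`. -/
structure IsRelCompl (G T K N : Submodule ℂ L) : Prop where
  lower_le : G ≤ N
  le_upper : N ≤ T
  upper_le : T ≤ N ⊔ K
  inf_eq_bot : N ⊓ K = ⊥

lemma bracketForm_apply (e x y : L) : bracketForm e x y = killingForm ℂ L ⁅e, x⁆ y := rfl

lemma bracketForm_neg (e x y : L) : bracketForm e x y = - bracketForm e y x := by
  rw [bracketForm_apply, bracketForm_apply, LieModule.traceForm_apply_lie_apply',
    LieModule.traceForm_comm]

lemma bracketForm_self (e x : L) : bracketForm e x x = 0 :=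
  self_eq_neg.mp (bracketForm_neg e x x)

lemma bracketForm_isRefl (e : L) : (bracketForm e).IsRefl := fun x y h => by
  rw [bracketForm_neg, h, neg_zero]

lemma mem_bracketPerp {e x : L} {W : Submodule ℂ L} :
    x ∈ bracketPerp e W ↔ ∀ y ∈ W, bracketForm e x y = 0 :=
  ⟨fun h y hy => bracketForm_isRefl e _ _ (h y hy),
    fun h y hy => bracketForm_isRefl e _ _ (h y hy)⟩

lemma bracketPerp_anti (e : L) {V W : Submodule ℂ L} (h : V ≤ W) :
    bracketPerp e W ≤ bracketPerp e V := fun _ hx =>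
  mem_bracketPerp.mpr fun y hy => mem_bracketPerp.mp hx y (h hy)

lemma bracketForm_of_mem_ker {e x : L} (hx : x ∈ LinearMap.ker (ad ℂ L e)) (y : L) :
    bracketForm e x y = 0 := by
  rw [bracketForm_apply, show ⁅e, x⁆ = 0 from hx, map_zero, LinearMap.zero_apply]

lemma ker_le_bracketPerp (e : L) (W : Submodule ℂ L) :
    LinearMap.ker (ad ℂ L e) ≤ bracketPerp e W := fun _ hx =>
  mem_bracketPerp.mpr fun y _ => bracketForm_of_mem_ker hx y

lemma le_bracketPerp_comm {e : L} {V W : Submodule ℂ L} :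
    V ≤ bracketPerp e W ↔ W ≤ bracketPerp e V :=
  ⟨fun h x hx => mem_bracketPerp.mpr fun _ hy =>
      bracketForm_isRefl e _ _ (mem_bracketPerp.mp (h hy) x hx),
    fun h x hx => mem_bracketPerp.mpr fun _ hy =>
      bracketForm_isRefl e _ _ (mem_bracketPerp.mp (h hy) x hx)⟩

lemma bracketPerp_eq_comap (e : L) (W : Submodule ℂ L) :
    bracketPerp e W
      = (LinearMap.BilinForm.orthogonal (killingForm ℂ L) W).comap (ad ℂ L e) := by
  ext x
  rw [mem_bracketPerp]
  refine forall₂_congr fun y _ => ?_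
  rw [bracketForm_apply, LieModule.traceForm_comm]
  rfl

section Dimension

variable [FiniteDimensional ℂ L] [LieAlgebra.IsSimple ℂ L]

lemma mem_ker_of_bracketForm_eq_zero {e x : L} (h : ∀ y, bracketForm e x y = 0) :
    x ∈ LinearMap.ker (ad ℂ L e) :=
  (IsKilling.killingForm_nondegenerate ℂ L).1 _ h

lemma finrank_add_finrank_bracketPerp {e : L} {W : Submodule ℂ L}
    (hW : W ⊓ LinearMap.ker (ad ℂ L e) = ⊥) :
    finrank ℂ W + finrank ℂ (bracketPerp e W) = finrank ℂ L := by
  have h := LinearMap.BilinForm.finrank_add_finrank_orthogonal (bracketForm_isRefl e) W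
  have h2 : W ⊓ (bracketForm e).orthogonal ⊤ = ⊥ := by
    rw [eq_bot_iff, ← hW]
    exact inf_le_inf_left _ fun x hx =>
      mem_ker_of_bracketForm_eq_zero fun y => mem_bracketPerp.mp hx y trivial
  rw [h2, finrank_bot, add_zero] at h
  exact h

lemma exists_mem_bracketPerp_notMem {e : L} {H N : Submodule ℂ L} (h : H < N)
    (hN : N ⊓ LinearMap.ker (ad ℂ L e) = ⊥) :
    ∃ v ∈ bracketPerp e H, v ∉ bracketPerp e N := by
  by_contra! hc
  have h1 := finrank_add_finrank_bracketPerp hN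
  have h2 := finrank_add_finrank_bracketPerp
    (eq_bot_iff.mpr ((inf_le_inf_right _ h.le).trans hN.le))
  have h3 := Submodule.finrank_mono hc
  have h4 := Submodule.finrank_lt_finrank_of_lt h
  omega

end Dimension


lemma IsRelCompl.finrank_eq [FiniteDimensional ℂ L] {G T K N : Submodule ℂ L}
    (h : IsRelCompl G T K N) :
    finrank ℂ N + finrank ℂ K = finrank ℂ (T ⊔ K : Submodule ℂ L) := by
  have h1 := Submodule.finrank_sup_add_finrank_inf_eq N K
  rw [h.inf_eq_bot, finrank_bot, add_zero,
    le_antisymm (sup_le_sup_right h.le_upper K) (sup_le h.upper_le le_sup_right)] at *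
  omega

lemma exists_isRelCompl {G T K n : Submodule ℂ L} (hG : G ≤ n) (hT : n ≤ T) (hn : n ⊓ K = ⊥) :
    ∃ N, IsRelCompl G T K N ∧ n ≤ N := by
  have hd : Disjoint n (K ⊓ T) := (disjoint_iff.mpr hn).mono_right inf_le_left
  obtain ⟨A, hA, hc⟩ := hd.exists_isCompl
  refine ⟨A ⊓ T, ⟨le_inf (hG.trans hA) (hG.trans hT), inf_le_right, ?_, ?_⟩, le_inf hA hT⟩
  · intro x hx
    obtain ⟨y, hy, z, hz, rfl⟩ := Submodule.mem_sup.mp (hc.sup_eq_top ▸ Submodule.mem_top : x ∈ _)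
    refine Submodule.add_mem_sup ⟨hy, ?_⟩ hz.1
    simpa using T.sub_mem hx hz.2
  · rw [inf_assoc, inf_comm T K, hc.inf_eq_bot]

/-- Two relative complements of `K ⊓ T` in `T` are joined by a chain of relative complements in
which any two neighbours share a hyperplane. -/
lemma IsRelCompl.rel_of_adjacent [FiniteDimensional ℂ L] {G T K : Submodule ℂ L}
    {r : Submodule ℂ L → Submodule ℂ L → Prop} (hrefl : ∀ N, r N N)
    (htrans : ∀ N₁ N₂ N₃, r N₁ N₂ → r N₂ N₃ → r N₁ N₃)
    (hadj : ∀ N N' H, IsRelCompl G T K N → IsRelCompl G T K N' → G ≤ H → H ≤ N → H ≤ N' →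
      finrank ℂ H + 1 = finrank ℂ N → r N N')
    {N N' : Submodule ℂ L} (hN : IsRelCompl G T K N) (hN' : IsRelCompl G T K N') : r N N' := by
  induction hd : finrank ℂ N' - finrank ℂ (N ⊓ N' : Submodule ℂ L) using Nat.strong_induction_on
    generalizing N with
  | _ d ih =>
  by_cases hle : N' ≤ N
  · have h1 := hN.finrank_eq
    have h2 := hN'.finrank_eq
    rw [Submodule.eq_of_le_of_finrank_eq hle (by omega)]
    exact hrefl N
  obtain ⟨y, hy', hy⟩ := SetLike.not_le_iff_exists.mp hle
  obtain ⟨n, hn, k, hk, rfl⟩ := Submodule.mem_sup.mp (hN.upper_le (hN'.le_upper hy'))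
  have hnN' : n ∉ N' := fun h => hy <| by
    have hk0 : k ∈ N' ⊓ K := ⟨by simpa using N'.sub_mem hy' h, hk⟩
    rw [hN'.inf_eq_bot, Submodule.mem_bot] at hk0
    simpa [hk0] using hn
  obtain ⟨f, hfn, hf⟩ := Submodule.exists_le_ker_of_notMem (fun h : n ∈ N ⊓ N' => hnN' h.2)
  set H := N ⊓ LinearMap.ker f with hH
  have hIH : N ⊓ N' ≤ H := le_inf inf_le_left hf
  have hnH : n ∉ H := fun h => hfn h.2
  have hykH : n + k ∉ H := fun h => hy h.1
  have hNH : N = H ⊔ ℂ ∙ n := by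
    refine le_antisymm (fun x hx => ?_)
      (sup_le inf_le_left (Submodule.span_singleton_le_iff_mem _ _ |>.mpr hn))
    refine Submodule.mem_sup.mpr ⟨x - (f x / f n) • n, ⟨N.sub_mem hx (N.smul_mem _ hn), ?_⟩,
      (f x / f n) • n, Submodule.smul_mem _ _ (Submodule.mem_span_singleton_self n), by simp⟩
    simp [hfn]
  have hfin : finrank ℂ H + 1 = finrank ℂ N := by
    rw [hNH]; exact (Submodule.finrank_sup_span_singleton hnH).symm
  have hM : IsRelCompl G T K (H ⊔ ℂ ∙ (n + k)) := by
    refine ⟨le_sup_of_le_left ((le_inf hN.lower_le hN'.lower_le).trans hIH), ?_, ?_, ?_⟩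
    · exact sup_le (inf_le_left.trans hN.le_upper)
        (Submodule.span_singleton_le_iff_mem _ _ |>.mpr (hN'.le_upper hy'))
    · refine hN.upper_le.trans (sup_le ?_ le_sup_right)
      rw [hNH]
      refine sup_le (le_sup_of_le_left le_sup_left)
        (Submodule.span_singleton_le_iff_mem _ _ |>.mpr ?_)
      have h1 : n + k ∈ H ⊔ ℂ ∙ (n + k) :=
        Submodule.mem_sup_right (Submodule.mem_span_singleton_self _)
      simpa using Submodule.sub_mem _ (Submodule.mem_sup_left (T := K) h1)
        (Submodule.mem_sup_right hk)
    · refine eq_bot_iff.mpr fun x hx => ?_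
      obtain ⟨h, hh, z, hz, rfl⟩ := Submodule.mem_sup.mp hx.1
      obtain ⟨c, rfl⟩ := Submodule.mem_span_singleton.mp hz
      have h1 : h + c • n ∈ N ⊓ K := ⟨N.add_mem hh.1 (N.smul_mem c hn), by
        have h2 := K.sub_mem hx.2 (K.smul_mem c hk)
        rwa [smul_add, ← add_assoc, add_sub_cancel_right] at h2⟩
      rw [hN.inf_eq_bot, Submodule.mem_bot] at h1
      have h3 : f (h + c • n) = 0 := by rw [h1, map_zero]
      have h4 : f h = 0 := hh.2
      have hc : c = 0 := by simpa [h4, hfn] using h3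
      have hh0 : h = 0 := by simpa [hc] using h1
      simp [hc, hh0]
  refine htrans _ _ _ (hadj N _ H hN hM ((le_inf hN.lower_le hN'.lower_le).trans hIH)
    inf_le_left le_sup_left hfin) (ih _ ?_ hM rfl)
  have hlt : N ⊓ N' < (H ⊔ ℂ ∙ (n + k)) ⊓ N' := by
    refine lt_of_le_not_ge (le_inf (hIH.trans le_sup_left) inf_le_right) fun h => hy (h ?_).1
    exact ⟨Submodule.mem_sup_right (Submodule.mem_span_singleton_self _), hy'⟩
  have h1 := Submodule.finrank_lt_finrank_of_lt hlt
  have h2 := Submodule.finrank_mono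
    (inf_le_right : (H ⊔ ℂ ∙ (n + k)) ⊓ N' ≤ N')
  omega

lemma isGradedSubmodule_iff_eq {g : ℚ → Submodule ℂ L} {W : Submodule ℂ L} :
    IsGradedSubmodule g W ↔ W = ⨆ j : ℚ, g j ⊓ W :=
  ⟨fun h => le_antisymm h (iSup_le fun _ => inf_le_right), fun h => h.le⟩

lemma IsGradedSubmodule.sup {g : ℚ → Submodule ℂ L} {V W : Submodule ℂ L}
    (hV : IsGradedSubmodule g V) (hW : IsGradedSubmodule g W) : IsGradedSubmodule g (V ⊔ W) :=
  sup_le (hV.trans (iSup_mono fun _ => inf_le_inf_left _ le_sup_left))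
    (hW.trans (iSup_mono fun _ => inf_le_inf_left _ le_sup_right))

lemma isGradedSubmodule_of_le {g : ℚ → Submodule ℂ L} {W : Submodule ℂ L} {c : ℚ} (h : W ≤ g c) :
    IsGradedSubmodule g W :=
  (le_inf h le_rfl).trans (le_iSup (fun j => g j ⊓ W) c)

lemma isGradedSubmodule_lowerPart (g : ℚ → Submodule ℂ L) (c : ℚ) :
    IsGradedSubmodule g (lowerPart g c) :=
  iSup₂_le fun j hj => (le_inf le_rfl (le_iSup₂ (f := fun i (_ : i ≤ c) => g i) j hj)).trans
    (le_iSup (fun i => g i ⊓ lowerPart g c) j)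

lemma isGradedSubmodule_of_le_sup {g : ℚ → Submodule ℂ L} {W : Submodule ℂ L} {c d : ℚ}
    (h1 : lowerPart g c ≤ W) (h2 : W ≤ lowerPart g c ⊔ g d) : IsGradedSubmodule g W := by
  have h : W = lowerPart g c ⊔ g d ⊓ W := by
    rw [← sup_inf_assoc_of_le _ h1, inf_eq_right.mpr h2]
  rw [h]
  exact (isGradedSubmodule_lowerPart g c).sup (isGradedSubmodule_of_le inf_le_left)

lemma le_lowerPart (g : ℚ → Submodule ℂ L) {c d : ℚ} (h : d ≤ c) : g d ≤ lowerPart g c :=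
  le_iSup₂ (f := fun i (_ : i ≤ c) => g i) d h

lemma le_negPart (g : ℚ → Submodule ℂ L) {d : ℚ} (h : d < 0) : g d ≤ negPart g :=
  le_iSup₂ (f := fun i (_ : i < 0) => g i) d h

lemma lowerPart_mono (g : ℚ → Submodule ℂ L) {c d : ℚ} (h : c ≤ d) :
    lowerPart g c ≤ lowerPart g d :=
  iSup₂_le fun _ hj => le_lowerPart g (hj.trans h)

/-- A property of pairs that is additive in each variable holds on two sums of homogeneous
components as soon as it holds on the components. -/
lemma biSup_induction₂ {g : ℚ → Submodule ℂ L} {p q : ℚ → Prop} {motive : L → L → Prop}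
    (h : ∀ i j, p i → q j → ∀ x ∈ g i, ∀ y ∈ g j, motive x y)
    (zero_left : ∀ y, motive 0 y) (zero_right : ∀ x, motive x 0)
    (add_left : ∀ x x' y, motive x y → motive x' y → motive (x + x') y)
    (add_right : ∀ x y y', motive x y → motive x y' → motive x (y + y'))
    {x y : L} (hx : x ∈ ⨆ i, ⨆ (_ : p i), g i) (hy : y ∈ ⨆ i, ⨆ (_ : q i), g i) :
    motive x y := by
  induction hx using Submodule.iSup_induction' with
  | zero => exact zero_left y
  | add x x' _ _ h1 h2 => exact add_left x x' y h1 h2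
  | mem i x hx =>
  induction hx using Submodule.iSup_induction' with
  | zero => exact zero_left y
  | add x x' _ _ h1 h2 => exact add_left x x' y h1 h2
  | mem hi x hx =>
  induction hy using Submodule.iSup_induction' with
  | zero => exact zero_right x
  | add y y' _ _ h1 h2 => exact add_right x y y' h1 h2
  | mem j y hy =>
  induction hy using Submodule.iSup_induction' with
  | zero => exact zero_right x
  | add y y' _ _ h1 h2 => exact add_right x y y' h1 h2
  | mem hj y hy => exact h i j hi hj x hx y hy

lemma lie_mem_lowerPart {g : ℚ → Submodule ℂ L} (hg : IsQGrading g) {c d s : ℚ} (hs : c + d ≤ s)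
    {x y : L} (hx : x ∈ lowerPart g c) (hy : y ∈ lowerPart g d) : ⁅x, y⁆ ∈ lowerPart g s := by
  refine biSup_induction₂ (motive := fun x y => ⁅x, y⁆ ∈ lowerPart g s)
    (fun i j hi hj x hx y hy => ?_) (by simp) (by simp)
    (fun x x' y h1 h2 => ?_) (fun x y y' h1 h2 => ?_) hx hy
  · exact le_lowerPart g (by linarith) (hg.2 i j x hx y hy)
  · rw [add_lie]; exact add_mem h1 h2
  · rw [lie_add]; exact add_mem h1 h2

lemma killingForm_eq_zero_of_add_ne_zero [FiniteDimensional ℂ L] {g : ℚ → Submodule ℂ L}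
    (hg : IsQGrading g) {i j : ℚ} (hij : i + j ≠ 0) {x y : L} (hx : x ∈ g i) (hy : y ∈ g j) :
    killingForm ℂ L x y = 0 := by
  rw [killingForm_apply_apply]
  refine LinearMap.trace_eq_zero_of_mapsTo_ne hg.1 (fun k => i + (j + k)) (fun k h => hij ?_)
    fun k z hz => hg.2 _ _ _ hx _ (hg.2 _ _ _ hy _ hz)
  linarith

lemma bracketForm_eq_zero_of_add_ne [FiniteDimensional ℂ L] {g : ℚ → Submodule ℂ L}
    (hg : IsQGrading g) {e : L} {a : ℚ} (he : e ∈ g a) {i j : ℚ} (hij : i + j ≠ -a)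
    {x y : L} (hx : x ∈ g i) (hy : y ∈ g j) : bracketForm e x y = 0 :=
  killingForm_eq_zero_of_add_ne_zero hg (fun h => hij (by linarith)) (hg.2 _ _ _ he _ hx) hy

lemma bracketForm_eq_zero_of_mem_biSup [FiniteDimensional ℂ L] {g : ℚ → Submodule ℂ L}
    (hg : IsQGrading g) {e : L} {a : ℚ} (he : e ∈ g a) {p q : ℚ → Prop}
    (hpq : ∀ i j, p i → q j → i + j ≠ -a) {x y : L}
    (hx : x ∈ ⨆ i, ⨆ (_ : p i), g i) (hy : y ∈ ⨆ i, ⨆ (_ : q i), g i) :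
    bracketForm e x y = 0 := by
  refine biSup_induction₂ (motive := fun x y => bracketForm e x y = 0)
    (fun i j hi hj x hx y hy => ?_) (by simp) (by simp)
    (fun x x' y h1 h2 => ?_) (fun x y y' h1 h2 => ?_) hx hy
  · exact bracketForm_eq_zero_of_add_ne hg he (hpq i j hi hj) hx hy
  · rw [map_add, LinearMap.add_apply, h1, h2, add_zero]
  · rw [map_add, h1, h2, add_zero]

section Admissible

variable {g : ℚ → Submodule ℂ L} {e : L} {a : ℤ} {m n : Submodule ℂ L}

lemma IsAdmissiblePairQ.bracketPerp_eq (h : IsAdmissiblePairQ g e a m n) :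
    bracketPerp e m = n ⊔ LinearMap.ker (ad ℂ L e) := by
  obtain ⟨-, -, -, -, -, -, -, h3, -⟩ := h
  rw [bracketPerp_eq_comap, ← Submodule.comap_map_eq, ← h3, Submodule.comap_inf,
    inf_eq_left.mpr]
  exact fun x _ => LinearMap.mem_range_self _ x

lemma IsAdmissiblePairQ.lowerPart_le (h : IsAdmissiblePairQ g e a m n) :
    lowerPart g (-(a : ℚ)) ≤ m := h.2.2.2.2.1

lemma IsAdmissiblePairQ.le (h : IsAdmissiblePairQ g e a m n) : m ≤ n := h.2.2.2.2.2.1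

lemma IsAdmissiblePairQ.le_negPart (h : IsAdmissiblePairQ g e a m n) : n ≤ negPart g :=
  h.2.2.2.2.2.2.1

lemma IsAdmissiblePairQ.inf_ker (h : IsAdmissiblePairQ g e a m n) :
    n ⊓ LinearMap.ker (ad ℂ L e) = ⊥ := h.2.2.2.2.2.2.2.2.1

variable [FiniteDimensional ℂ L]

lemma IsAdmissiblePairQ.finrank_eq (h : IsAdmissiblePairQ g e a m n) :
    finrank ℂ m + finrank ℂ n + finrank ℂ (LinearMap.ker (ad ℂ L e)) = finrank ℂ L := by
  have h6 := h.2.2.2.2.2.2.2.2.2.2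
  have := Submodule.finrank_le (LinearMap.ker (ad ℂ L e))
  omega

lemma bracketForm_eq_zero_of_mem_lowerPart (hg : IsQGrading g) (he : e ∈ g (a : ℚ)) {c d : ℚ}
    (hcd : c + d < -(a : ℚ)) {x y : L} (hx : x ∈ lowerPart g c) (hy : y ∈ lowerPart g d) :
    bracketForm e x y = 0 :=
  bracketForm_eq_zero_of_mem_biSup hg he (fun _ _ hi hj => ne_of_lt (by linarith)) hx hy

lemma negPart_le_bracketPerp_lowerPart (hg : IsQGrading g) (he : e ∈ g (a : ℚ)) :
    negPart g ≤ bracketPerp e (lowerPart g (-(a : ℚ))) := fun _ hx =>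
  mem_bracketPerp.mpr fun _ hy => bracketForm_eq_zero_of_mem_biSup hg he
    (fun _ _ hi hj => ne_of_lt (by linarith)) hx hy

variable [LieAlgebra.IsSimple ℂ L]

lemma mem_ker_of_bracketForm_homogeneous_eq_zero (hg : IsQGrading g) {x : L}
    (h : ∀ j, ∀ y ∈ g j, bracketForm e x y = 0) : x ∈ LinearMap.ker (ad ℂ L e) := by
  refine mem_ker_of_bracketForm_eq_zero fun y => ?_
  have hy : y ∈ iSup g := hg.1.submodule_iSup_eq_top ▸ Submodule.mem_top
  induction hy using Submodule.iSup_induction' with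
  | zero => simp
  | add y y' _ _ h1 h2 => rw [map_add, h1, h2, add_zero]
  | mem j y hy => exact h j y hy

lemma mem_ker_of_mem_of_bracketForm_eq_zero (hg : IsQGrading g) (he : e ∈ g (a : ℚ)) {i k : ℚ}
    (hik : i + k = -(a : ℚ)) {v : L} (hv : v ∈ g i) (h : ∀ y ∈ g k, bracketForm e v y = 0) :
    v ∈ LinearMap.ker (ad ℂ L e) := by
  refine mem_ker_of_bracketForm_homogeneous_eq_zero hg fun j y hy => ?_
  by_cases hj : j = k
  · exact h y (hj ▸ hy)
  · exact bracketForm_eq_zero_of_add_ne hg he (fun h => hj (by linarith)) hv hy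

lemma bracketPerp_lowerPart_le (hg : IsQGrading g) (he : e ∈ g (a : ℚ)) :
    bracketPerp e (lowerPart g (-(a : ℚ))) ≤ negPart g ⊔ LinearMap.ker (ad ℂ L e) := by
  intro x hx
  have htop : (negPart g ⊔ ⨆ j, ⨆ (_ : 0 ≤ j), g j) = ⊤ := by
    rw [eq_top_iff, ← hg.1.submodule_iSup_eq_top]
    refine iSup_le fun j => ?_
    rcases lt_or_ge j 0 with hj | hj
    · exact le_sup_of_le_left (le_negPart g hj)
    · exact le_sup_of_le_right (le_iSup₂ (f := fun i (_ : 0 ≤ i) => g i) j hj)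
  obtain ⟨p, hp, q, hq, rfl⟩ := Submodule.mem_sup.mp (htop ▸ Submodule.mem_top : x ∈ _)
  refine Submodule.add_mem_sup hp (mem_ker_of_bracketForm_homogeneous_eq_zero hg fun j y hy => ?_)
  have hy' : y ∈ ⨆ i, ⨆ (_ : i = j), g i := by simpa using hy
  rcases le_or_gt j (-(a : ℚ)) with hj | hj
  · have h1 := mem_bracketPerp.mp hx y (le_lowerPart g hj hy)
    have h2 : bracketForm e p y = 0 := bracketForm_eq_zero_of_mem_biSup hg he
      (fun i i' hi hi' => by subst hi'; exact ne_of_lt (by linarith)) hp hy'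
    rwa [map_add, LinearMap.add_apply, h2, zero_add] at h1
  · exact bracketForm_eq_zero_of_mem_biSup hg he
      (fun i i' hi hi' => by subst hi'; exact ne_of_gt (by linarith)) hq hy'

lemma IsAdmissiblePairQ.of_bracketPerp_le (hm : IsGradedSubmodule g m)
    (hn : IsGradedSubmodule g n) (hGm : lowerPart g (-(a : ℚ)) ≤ m) (hmn : m ≤ n)
    (hnP : n ≤ negPart g) (hnn : ∀ x ∈ n, ∀ y ∈ n, ⁅x, y⁆ ∈ n)
    (hnm : ∀ x ∈ n, ∀ y ∈ m, ⁅x, y⁆ ∈ m) (hle : n ≤ bracketPerp e m)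
    (hperp : bracketPerp e m ≤ n ⊔ LinearMap.ker (ad ℂ L e))
    (hK : n ⊓ LinearMap.ker (ad ℂ L e) = ⊥) : IsAdmissiblePairQ g e a m n := by
  have heq : bracketPerp e m = n ⊔ LinearMap.ker (ad ℂ L e) :=
    le_antisymm hperp (sup_le hle (ker_le_bracketPerp e m))
  refine ⟨fun x hx => hnm x (hmn hx), hnn, isGradedSubmodule_iff_eq.mp hm,
    isGradedSubmodule_iff_eq.mp hn, hGm, hmn, hnP, ?_, hK, hnm, ?_⟩
  · rw [inf_comm, ← Submodule.map_comap_eq, ← bracketPerp_eq_comap, heq, Submodule.map_sup,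
      LinearMap.le_ker_iff_map.mp le_rfl, sup_bot_eq]
  · have h1 := finrank_add_finrank_bracketPerp
      (eq_bot_iff.mpr ((inf_le_inf_right _ hmn).trans hK.le))
    have h2 := Submodule.finrank_sup_add_finrank_inf_eq n (LinearMap.ker (ad ℂ L e))
    rw [hK, finrank_bot] at h2
    rw [heq] at h1
    omega

lemma IsAdmissiblePairQ.of_finrank_eq (hm : IsGradedSubmodule g m)
    (hn : IsGradedSubmodule g n) (hGm : lowerPart g (-(a : ℚ)) ≤ m) (hmn : m ≤ n)
    (hnP : n ≤ negPart g) (hnn : ∀ x ∈ n, ∀ y ∈ n, ⁅x, y⁆ ∈ n)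
    (hnm : ∀ x ∈ n, ∀ y ∈ m, ⁅x, y⁆ ∈ m) (hle : n ≤ bracketPerp e m)
    (hdim : finrank ℂ m + finrank ℂ n + finrank ℂ (LinearMap.ker (ad ℂ L e)) = finrank ℂ L)
    (hK : n ⊓ LinearMap.ker (ad ℂ L e) = ⊥) : IsAdmissiblePairQ g e a m n := by
  refine .of_bracketPerp_le hm hn hGm hmn hnP hnn hnm hle (ge_of_eq ?_) hK
  refine Submodule.eq_of_le_of_finrank_eq (sup_le hle (ker_le_bracketPerp e m)) ?_
  have h1 := finrank_add_finrank_bracketPerp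
    (eq_bot_iff.mpr ((inf_le_inf_right _ hmn).trans hK.le))
  have h2 := Submodule.finrank_sup_add_finrank_inf_eq n (LinearMap.ker (ad ℂ L e))
  rw [hK, finrank_bot] at h2
  omega

end Admissible

lemma EquivalentPairs.symm {e : L} {p q : Submodule ℂ L × Submodule ℂ L}
    (h : EquivalentPairs e p q) : EquivalentPairs e q p :=
  have : Std.Symm (ComparablePairs e) :=
    ⟨fun _ _ ⟨g, a, h1, h2, h3, h4, h5, h6⟩ => ⟨g, a, h1, h2, h3, h5, h4, h6.symm⟩⟩
  Relation.ReflTransGen.stdSymm.symm _ _ h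

lemma EquivalentPairs.of_le {g : ℚ → Submodule ℂ L} {e : L} {a : ℤ} (hg : IsQGrading g)
    (ha : 1 < a) (he : e ∈ g (a : ℚ)) {m n m' n' : Submodule ℂ L}
    (h : IsAdmissiblePairQ g e a m n) (h' : IsAdmissiblePairQ g e a m' n')
    (hm : m ≤ m') (hn : n' ≤ n) : EquivalentPairs e (m, n) (m', n') :=
  .single ⟨g, a, hg, ha, he, h, h', Or.inl ⟨hm, h'.2.2.2.2.2.1, hn⟩⟩

section Equivalence

variable [FiniteDimensional ℂ L] [LieAlgebra.IsSimple ℂ L] {g : ℚ → Submodule ℂ L} {e : L} {a : ℤ}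

/-- The equivalence of all admissible pairs when the negative part is concentrated in degrees at
most `-a` and one further degree `d ≤ -a / 2`. -/
lemma equivalentPairs_of_negPart_eq_sup (hg : IsQGrading g) (ha : 1 < a) (he : e ∈ g (a : ℚ))
    {d : ℚ} (hd : d + d ≤ -(a : ℚ)) (had : -(a : ℚ) ≤ d)
    (hP : negPart g = lowerPart g (-(a : ℚ)) ⊔ g d) {m₁ n₁ m₂ n₂ : Submodule ℂ L}
    (h₁ : IsAdmissiblePairQ g e a m₁ n₁) (h₂ : IsAdmissiblePairQ g e a m₂ n₂) :
    EquivalentPairs e (m₁, n₁) (m₂, n₂) := by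
  set G := lowerPart g (-(a : ℚ)) with hG
  set K := LinearMap.ker (ad ℂ L e) with hK
  have hPd : negPart g ≤ lowerPart g d :=
    hP.le.trans (sup_le (lowerPart_mono g had) (le_lowerPart g le_rfl))
  have hlie : ∀ x ∈ negPart g, ∀ y ∈ negPart g, ⁅x, y⁆ ∈ G := fun x hx y hy =>
    lie_mem_lowerPart hg hd (hPd hx) (hPd hy)
  have hPG := negPart_le_bracketPerp_lowerPart hg he
  have hGP : G ≤ negPart g := h₁.lowerPart_le.trans (h₁.le.trans h₁.le_negPart)
  have hgr : ∀ W, G ≤ W → W ≤ negPart g → IsGradedSubmodule g W := fun W h h' =>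
    isGradedSubmodule_of_le_sup h (hP ▸ h')
  have hmin : ∀ N, IsRelCompl G (negPart g) K N → IsAdmissiblePairQ g e a G N := fun N hN =>
    .of_bracketPerp_le (hgr G le_rfl hGP) (hgr N hN.lower_le hN.le_upper) le_rfl hN.lower_le
      hN.le_upper (fun x hx y hy => hN.lower_le (hlie x (hN.le_upper hx) y (hN.le_upper hy)))
      (fun x hx y hy => hlie x (hN.le_upper hx) y (hGP hy)) (hN.le_upper.trans hPG)
      ((bracketPerp_lowerPart_le hg he).trans (sup_le hN.upper_le le_sup_right)) hN.inf_eq_bot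
  have hadj : ∀ N N', IsRelCompl G (negPart g) K N → IsRelCompl G (negPart g) K N' →
      EquivalentPairs e (G, N) (G, N') := by
    refine fun N N' => IsRelCompl.rel_of_adjacent
      (r := fun N N' => EquivalentPairs e (G, N) (G, N')) (fun _ => .refl)
      (fun _ _ _ => Relation.ReflTransGen.trans) fun N N' H hN hN' hGH hHN hHN' hdim => ?_
    have hne : H < N := lt_of_le_of_ne hHN (by rintro rfl; omega)
    obtain ⟨v, hvH, hvN⟩ := exists_mem_bracketPerp_notMem hne hN.inf_eq_bot
    obtain ⟨p, hp, k, hk, rfl⟩ := Submodule.mem_sup.mp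
      ((bracketPerp_lowerPart_le hg he) (bracketPerp_anti e hGH hvH))
    obtain ⟨v, hv, k', hk', rfl⟩ := Submodule.mem_sup.mp (hN.upper_le hp)
    have hkk : k' + k ∈ K := K.add_mem hk' hk
    rw [add_assoc] at hvH hvN
    replace hvH : v ∈ bracketPerp e H := by
      simpa using Submodule.sub_mem _ hvH (ker_le_bracketPerp e H hkk)
    replace hvN : v ∉ bracketPerp e N := fun h =>
      hvN (Submodule.add_mem _ h (ker_le_bracketPerp e N hkk))
    have hvH' : v ∈ H := by
      by_contra hc
      have hNv : H ⊔ ℂ ∙ v = N := Submodule.eq_of_le_of_finrank_eq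
        (sup_le hHN (Submodule.span_singleton_le_iff_mem _ _ |>.mpr hv))
        (by rw [Submodule.finrank_sup_span_singleton hc, hdim])
      apply hvN
      rw [← Submodule.span_singleton_le_iff_mem, le_bracketPerp_comm, ← hNv]
      refine sup_le ?_ ?_
      · rwa [le_bracketPerp_comm, Submodule.span_singleton_le_iff_mem]
      · rw [Submodule.span_singleton_le_iff_mem]
        refine mem_bracketPerp.mpr fun y hy => ?_
        obtain ⟨c, rfl⟩ := Submodule.mem_span_singleton.mp hy
        rw [map_smul, bracketForm_self, smul_zero]
    have hvG : v ∉ G := fun h => hvN <| by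
      rw [← Submodule.span_singleton_le_iff_mem, le_bracketPerp_comm]
      exact (hN.le_upper.trans hPG).trans (bracketPerp_anti e
        (Submodule.span_singleton_le_iff_mem _ _ |>.mpr h))
    have hsup : G ⊔ ℂ ∙ v ≤ H := sup_le hGH (Submodule.span_singleton_le_iff_mem _ _ |>.mpr hvH')
    have hHP : H ≤ negPart g := hHN.trans hN.le_upper
    have hmid : IsAdmissiblePairQ g e a (G ⊔ ℂ ∙ v) H := by
      refine .of_finrank_eq (hgr _ le_sup_left (hsup.trans hHP)) (hgr H hGH hHP) le_sup_left hsup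
        hHP (fun x hx y hy => hGH (hlie x (hHP hx) y (hHP hy)))
        (fun x hx y hy => Submodule.mem_sup_left (hlie x (hHP hx) y (hHP (hsup hy)))) ?_ ?_
        (eq_bot_iff.mpr ((inf_le_inf_right _ hHN).trans hN.inf_eq_bot.le))
      · rw [le_bracketPerp_comm]
        refine sup_le (le_bracketPerp_comm.mp (hHP.trans hPG)) ?_
        exact Submodule.span_singleton_le_iff_mem _ _ |>.mpr hvH
      · rw [Submodule.finrank_sup_span_singleton hvG]
        have := (hmin N hN).finrank_eq
        omega
    exact (EquivalentPairs.of_le hg ha he (hmin N hN) hmid le_sup_left hHN).trans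
      (EquivalentPairs.of_le hg ha he (hmin N' hN') hmid le_sup_left hHN').symm
  have hred : ∀ m n, IsAdmissiblePairQ g e a m n → ∃ N, IsRelCompl G (negPart g) K N ∧
      EquivalentPairs e (G, N) (m, n) := fun m n h => by
    obtain ⟨N, hN, hnN⟩ := exists_isRelCompl (h.lowerPart_le.trans h.le) h.le_negPart h.inf_ker
    exact ⟨N, hN, EquivalentPairs.of_le hg ha he (hmin N hN) h h.lowerPart_le hnN⟩
  obtain ⟨N₁, hN₁, hr₁⟩ := hred m₁ n₁ h₁
  obtain ⟨N₂, hN₂, hr₂⟩ := hred m₂ n₂ h₂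
  exact (hr₁.symm.trans (hadj N₁ N₂ hN₁ hN₂)).trans hr₂

/-- The equivalence of all admissible pairs when the negative part is concentrated in degrees at
most `-a` and two further degrees `c < d` with `c + d = -a`. -/
lemma equivalentPairs_of_negPart_eq_sup_sup (hg : IsQGrading g) (ha : 1 < a)
    (he : e ∈ g (a : ℚ)) {c d : ℚ} (hcd : c + d = -(a : ℚ)) (hlt : c < d) (hd : d < 0)
    (hP : negPart g = lowerPart g (-(a : ℚ)) ⊔ (g c ⊔ g d)) {m₁ n₁ m₂ n₂ : Submodule ℂ L}
    (h₁ : IsAdmissiblePairQ g e a m₁ n₁) (h₂ : IsAdmissiblePairQ g e a m₂ n₂) :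
    EquivalentPairs e (m₁, n₁) (m₂, n₂) := by
  set G := lowerPart g (-(a : ℚ)) with hG
  set K := LinearMap.ker (ad ℂ L e) with hK
  set Q := G ⊔ g c with hQ
  have hPQ : negPart g = Q ⊔ g d := by rw [hP, hQ, sup_assoc]
  have hGQ : G ≤ Q := le_sup_left
  have hQP : Q ≤ negPart g := hPQ ▸ le_sup_left
  have hGP : G ≤ negPart g := hGQ.trans hQP
  have hdP : g d ≤ negPart g := hPQ ▸ le_sup_right
  have hQc : Q ≤ lowerPart g c :=
    sup_le (lowerPart_mono g (by linarith)) (le_lowerPart g le_rfl)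
  have hPd : negPart g ≤ lowerPart g d := hPQ ▸
    sup_le (hQc.trans (lowerPart_mono g hlt.le)) (le_lowerPart g le_rfl)
  have hPQlie : ∀ x ∈ negPart g, ∀ y ∈ Q, ⁅x, y⁆ ∈ G := fun x hx y hy =>
    lie_mem_lowerPart hg (by linarith) (hPd hx) (hQc hy)
  have hQPlie : ∀ x ∈ Q, ∀ y ∈ negPart g, ⁅x, y⁆ ∈ G := fun x hx y hy =>
    lie_mem_lowerPart hg (by linarith) (hQc hx) (hPd hy)
  have hQQ : Q ≤ bracketPerp e Q := fun x hx => mem_bracketPerp.mpr fun y hy =>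
    bracketForm_eq_zero_of_mem_lowerPart hg he (by linarith) (hQc hx) (hQc hy)
  have hdd : g d ≤ bracketPerp e (g d) := fun x hx => mem_bracketPerp.mpr fun y hy =>
    bracketForm_eq_zero_of_add_ne hg he (ne_of_gt (by linarith)) hx hy
  have hker : ∀ v ∈ g d, v ∈ bracketPerp e Q → v ∈ K := fun v hv h =>
    mem_ker_of_mem_of_bracketForm_eq_zero hg he (k := c) (by linarith) hv fun y hy =>
      mem_bracketPerp.mp h y (le_sup_right (a := G) hy)
  have hdec : ∀ W, G ≤ W → ∀ x ∈ bracketPerp e W, ∃ v ∈ g d, ∃ q ∈ Q, ∃ k ∈ K,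
      x = v + q + k := fun W hW x hx => by
    obtain ⟨p, hp, k, hk, rfl⟩ := Submodule.mem_sup.mp
      ((bracketPerp_lowerPart_le hg he) (bracketPerp_anti e hW hx))
    obtain ⟨q, hq, v, hv, rfl⟩ := Submodule.mem_sup.mp (hPQ ▸ hp)
    exact ⟨v, hv, q, hq, k, hk, by rw [add_comm v q]⟩
  have hdperp : ∀ W, W ≤ Q → ∀ v, ∀ q ∈ Q, ∀ k ∈ K, v + q + k ∈ bracketPerp e W →
      v ∈ bracketPerp e W := fun W hW v q hq k hk h => by
    have h1 := Submodule.sub_mem _ h (ker_le_bracketPerp e W hk)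
    have h2 := Submodule.sub_mem _ h1 (bracketPerp_anti e hW (hQQ hq))
    simpa using h2
  have hgr : ∀ W, G ≤ W → W ≤ Q → IsGradedSubmodule g W := fun W h h' =>
    isGradedSubmodule_of_le_sup h h'
  have hQN : ∀ N, IsRelCompl G Q K N → bracketPerp e N ≤ bracketPerp e Q := fun N hN => by
    rw [le_bracketPerp_comm]
    exact hN.upper_le.trans (sup_le (le_bracketPerp_comm.mp le_rfl) (ker_le_bracketPerp e _))
  have hlag : ∀ N, IsRelCompl G Q K N → IsAdmissiblePairQ g e a N N := fun N hN => by
    have hlie : ∀ x ∈ N, ∀ y ∈ N, ⁅x, y⁆ ∈ N := fun x hx y hy =>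
      hN.lower_le (hQPlie x (hN.le_upper hx) y (hQP (hN.le_upper hy)))
    refine .of_bracketPerp_le (hgr N hN.lower_le hN.le_upper) (hgr N hN.lower_le hN.le_upper)
      hN.lower_le le_rfl (hN.le_upper.trans hQP) hlie hlie
      ((hN.le_upper.trans hQQ).trans (bracketPerp_anti e hN.le_upper)) ?_ hN.inf_eq_bot
    intro x hx
    obtain ⟨v, hv, q, hq, k, hk, rfl⟩ := hdec N hN.lower_le x hx
    have hvK := hker v hv (hQN N hN (hdperp N hN.le_upper v q hq k hk hx))
    exact Submodule.add_mem _ (Submodule.add_mem _ (Submodule.mem_sup_right hvK)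
      (hN.upper_le hq)) (Submodule.mem_sup_right hk)
  have hadj : ∀ N N', IsRelCompl G Q K N → IsRelCompl G Q K N' →
      EquivalentPairs e (N, N) (N', N') := by
    refine fun N N' => IsRelCompl.rel_of_adjacent
      (r := fun N N' => EquivalentPairs e (N, N) (N', N')) (fun _ => .refl)
      (fun _ _ _ => Relation.ReflTransGen.trans) fun N N' H hN hN' hGH hHN hHN' hdim => ?_
    have hne : H < N := lt_of_le_of_ne hHN (by rintro rfl; omega)
    have hHQ : H ≤ Q := hHN.trans hN.le_upper
    obtain ⟨x, hxH, hxN⟩ := exists_mem_bracketPerp_notMem hne hN.inf_eq_bot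
    obtain ⟨v, hv, q, hq, k, hk, rfl⟩ := hdec H hGH x hxH
    have hvH := hdperp H hHQ v q hq k hk hxH
    have hvQ : v ∉ bracketPerp e Q := fun h => hxN <|
      Submodule.add_mem _ (Submodule.add_mem _ (bracketPerp_anti e hN.le_upper h)
        (bracketPerp_anti e hN.le_upper (hQQ hq))) (ker_le_bracketPerp e N hk)
    have hvnot : ∀ W, W ≤ Q → v ∉ W := fun W hW h => hvQ (hQQ (hW h))
    have hspan : ℂ ∙ v ≤ negPart g := Submodule.span_singleton_le_iff_mem _ _ |>.mpr (hdP hv)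
    have hspanH : ℂ ∙ v ≤ bracketPerp e H := Submodule.span_singleton_le_iff_mem _ _ |>.mpr hvH
    have hspang : IsGradedSubmodule g (ℂ ∙ v) :=
      isGradedSubmodule_of_le (Submodule.span_singleton_le_iff_mem _ _ |>.mpr hv)
    have hspans : ℂ ∙ v ≤ bracketPerp e (ℂ ∙ v) := by
      have h : ℂ ∙ v ≤ g d := Submodule.span_singleton_le_iff_mem _ _ |>.mpr hv
      exact (h.trans hdd).trans (bracketPerp_anti e h)
    have hlie : ∀ W, W ≤ Q → ∀ x ∈ W ⊔ ℂ ∙ v, ∀ y ∈ W ⊔ ℂ ∙ v, ⁅x, y⁆ ∈ G := by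
      intro W hW x hx y hy
      obtain ⟨w, hw, z, hz, rfl⟩ := Submodule.mem_sup.mp hx
      obtain ⟨w', hw', z', hz', rfl⟩ := Submodule.mem_sup.mp hy
      have hzz : ⁅z, z'⁆ = 0 := by
        obtain ⟨s, rfl⟩ := Submodule.mem_span_singleton.mp hz
        obtain ⟨s', rfl⟩ := Submodule.mem_span_singleton.mp hz'
        simp
      rw [add_lie, lie_add z, hzz, add_zero]
      exact G.add_mem (hQPlie w (hW hw) _ ((sup_le (hW.trans hQP) hspan) hy))
        (hPQlie z (hspan hz) w' (hW hw'))
    have hinf : ∀ M, IsRelCompl G Q K M → (M ⊔ ℂ ∙ v) ⊓ K = ⊥ := fun M hM => by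
      refine eq_bot_iff.mpr fun x hx => ?_
      obtain ⟨w, hw, z, hz, rfl⟩ := Submodule.mem_sup.mp hx.1
      obtain ⟨s, rfl⟩ := Submodule.mem_span_singleton.mp hz
      have h1 : s • v ∈ bracketPerp e Q := by
        simpa using Submodule.sub_mem _ (ker_le_bracketPerp e Q hx.2) (hQQ (hM.le_upper hw))
      have hs : s = 0 := by
        by_contra hs
        exact hvQ ((Submodule.smul_mem_iff _ hs).mp h1)
      have h2 := hx.2
      rw [hs, zero_smul, add_zero] at h2 ⊢
      exact hM.inf_eq_bot.le ⟨hw, h2⟩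
    have hup : ∀ M, IsRelCompl G Q K M → H ≤ M → finrank ℂ M = finrank ℂ N →
        IsAdmissiblePairQ g e a H (M ⊔ ℂ ∙ v) := fun M hM hHM hMN => by
      refine .of_finrank_eq (hgr H hGH hHQ) ((hgr M hM.lower_le hM.le_upper).sup hspang) hGH
        (le_sup_of_le_left hHM) (sup_le (hM.le_upper.trans hQP) hspan)
        (fun x hx y hy => Submodule.mem_sup_left (hM.lower_le (hlie M hM.le_upper x hx y hy)))
        (fun x hx y hy => hGH (hlie M hM.le_upper x hx y (Submodule.mem_sup_left (hHM hy))))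
        (sup_le ((hM.le_upper.trans hQQ).trans (bracketPerp_anti e hHQ)) hspanH) ?_ (hinf M hM)
      rw [Submodule.finrank_sup_span_singleton (hvnot M hM.le_upper)]
      have := (hlag N hN).finrank_eq
      omega
    have hmid : IsAdmissiblePairQ g e a (H ⊔ ℂ ∙ v) (H ⊔ ℂ ∙ v) := by
      have hl : ∀ x ∈ H ⊔ ℂ ∙ v, ∀ y ∈ H ⊔ ℂ ∙ v, ⁅x, y⁆ ∈ H ⊔ ℂ ∙ v := fun x hx y hy =>
        Submodule.mem_sup_left (hGH (hlie H hHQ x hx y hy))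
      have hgrad := (hgr H hGH hHQ).sup hspang
      refine .of_finrank_eq hgrad hgrad (le_sup_of_le_left hGH) le_rfl
        (sup_le (hHQ.trans hQP) hspan) hl hl ?_ ?_
        (eq_bot_iff.mpr ((inf_le_inf_right _ (sup_le_sup_right hHN _)).trans (hinf N hN).le))
      · refine sup_le (le_bracketPerp_comm.mp (sup_le ?_ hspanH))
          (le_bracketPerp_comm.mp (sup_le (le_bracketPerp_comm.mp hspanH) hspans))
        exact (hHQ.trans hQQ).trans (bracketPerp_anti e hHQ)
      · rw [Submodule.finrank_sup_span_singleton (hvnot H hHQ)]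
        have := (hlag N hN).finrank_eq
        omega
    have hpath : ∀ M, IsRelCompl G Q K M → H ≤ M → finrank ℂ M = finrank ℂ N →
        EquivalentPairs e (M, M) (H ⊔ ℂ ∙ v, H ⊔ ℂ ∙ v) := fun M hM hHM hMN =>
      (EquivalentPairs.of_le hg ha he (hup M hM hHM hMN) (hlag M hM) hHM le_sup_left).symm.trans
        (EquivalentPairs.of_le hg ha he (hup M hM hHM hMN) hmid le_sup_left
          (sup_le_sup_right hHM _))
    have h1 := hN.finrank_eq
    have h2 := hN'.finrank_eq
    exact (hpath N hN hHN rfl).trans (hpath N' hN' hHN' (by omega)).symm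
  have hsplit : ∀ n, IsGradedSubmodule g n → n ≤ negPart g → n ≤ (n ⊓ Q) ⊔ (n ⊓ g d) := by
    intro n hn hnP
    refine hn.trans (iSup_le fun j => ?_)
    by_cases hjd : j = d
    · exact le_sup_of_le_right (hjd ▸ inf_comm (g j) n ▸ le_rfl)
    by_cases hj : j ≤ -(a : ℚ) ∨ j = c
    · refine le_sup_of_le_left (le_inf inf_le_right (inf_le_left.trans ?_))
      rcases hj with hj | rfl
      · exact (le_lowerPart g hj).trans hGQ
      · exact le_sup_right
    · have hle : negPart g ≤ ⨆ i ∈ {i | i ≤ -(a : ℚ) ∨ i = c ∨ i = d}, g i := by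
        rw [hP]
        refine sup_le (iSup₂_le fun i hi => ?_) (sup_le ?_ ?_)
        · exact le_iSup₂_of_le i (Or.inl hi) le_rfl
        · exact le_iSup₂_of_le c (Or.inr (Or.inl rfl)) le_rfl
        · exact le_iSup₂_of_le d (Or.inr (Or.inr rfl)) le_rfl
      have hdis := (hg.1.submodule_iSupIndep).disjoint_biSup
        (x := j) (y := {i | i ≤ -(a : ℚ) ∨ i = c ∨ i = d}) (fun h => by
          rcases h with h | h | h
          · exact hj (Or.inl h)
          · exact hj (Or.inr h)
          · exact hjd h)
      exact (inf_le_inf_left _ (hnP.trans hle)).trans (hdis.eq_bot.le.trans bot_le)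
  have hred : ∀ m n, IsAdmissiblePairQ g e a m n → ∃ N, IsRelCompl G Q K N ∧
      EquivalentPairs e (N, N) (m, n) := fun m n h => by
    have hm : IsGradedSubmodule g m := isGradedSubmodule_iff_eq.mpr h.2.2.1
    have hn : IsGradedSubmodule g n := isGradedSubmodule_iff_eq.mpr h.2.2.2.1
    have hGm := h.lowerPart_le
    have hnm := h.2.2.2.2.2.2.2.2.2.1
    have hnn := h.2.1
    obtain ⟨N, hN, hnN⟩ := exists_isRelCompl (G := G) (T := Q) (K := K) (n := n ⊓ Q)
      (le_inf (hGm.trans h.le) hGQ) inf_le_right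
      (eq_bot_iff.mpr ((inf_le_inf_right _ inf_le_left).trans h.inf_ker.le))
    have hNP : N ≤ negPart g := hN.le_upper.trans hQP
    have hmid : IsAdmissiblePairQ g e a (m ⊓ Q) (n ⊔ N) := by
      have hlow : G ≤ m ⊓ Q := le_inf hGm hGQ
      refine .of_bracketPerp_le (hgr _ hlow inf_le_right)
        (hn.sup (hgr N hN.lower_le hN.le_upper)) hlow
        (inf_le_left.trans (h.le.trans le_sup_left)) (sup_le h.le_negPart hNP) ?_ ?_ ?_ ?_ ?_
      · intro x hx y hy
        obtain ⟨x, hxn, x', hxN, rfl⟩ := Submodule.mem_sup.mp hx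
        obtain ⟨y, hyn, y', hyN, rfl⟩ := Submodule.mem_sup.mp hy
        rw [add_lie, lie_add x]
        refine Submodule.add_mem _ (Submodule.add_mem _ (Submodule.mem_sup_left (hnn x hxn y hyn))
          (Submodule.mem_sup_right (hN.lower_le ?_))) (Submodule.mem_sup_right (hN.lower_le ?_))
        · exact hPQlie x (h.le_negPart hxn) y' (hN.le_upper hyN)
        · exact hQPlie x' (hN.le_upper hxN) _ (sup_le h.le_negPart hNP hy)
      · exact fun x hx y hy => hlow (hPQlie x (sup_le h.le_negPart hNP hx) y hy.2)
      · refine sup_le ?_ ((hN.le_upper.trans hQQ).trans (bracketPerp_anti e inf_le_right))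
        exact (le_sup_left.trans h.bracketPerp_eq.ge).trans (bracketPerp_anti e inf_le_left)
      · intro x hx
        obtain ⟨v, hv, q, hq, k, hk, rfl⟩ := hdec _ hlow x hx
        have hv' := hdperp _ inf_le_right v q hq k hk hx
        have hvm : v ∈ bracketPerp e m := by
          rw [← Submodule.span_singleton_le_iff_mem, le_bracketPerp_comm]
          refine (hsplit m hm (h.le.trans h.le_negPart)).trans (sup_le ?_ ?_)
          · rwa [le_bracketPerp_comm, Submodule.span_singleton_le_iff_mem]
          · refine (inf_le_right.trans hdd).trans (bracketPerp_anti e ?_)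
            exact Submodule.span_singleton_le_iff_mem _ _ |>.mpr hv
        rw [h.bracketPerp_eq] at hvm
        exact Submodule.add_mem _ (Submodule.add_mem _ (sup_le_sup_right le_sup_left K hvm)
          (sup_le_sup_right le_sup_right K (hN.upper_le hq))) (Submodule.mem_sup_right hk)
      · refine eq_bot_iff.mpr fun x hx => ?_
        obtain ⟨y, hy, z, hz, rfl⟩ := Submodule.mem_sup.mp hx.1
        obtain ⟨q, hq, v, hv, rfl⟩ := Submodule.mem_sup.mp (hsplit n hn h.le_negPart hy)
        have hvQ : v ∈ bracketPerp e Q := by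
          have h1 := Submodule.sub_mem _ (ker_le_bracketPerp e Q hx.2)
            (Submodule.add_mem _ (hQQ hq.2) (hQQ (hN.le_upper hz)))
          rwa [show q + v + z - (q + z) = v by abel] at h1
        have hv0 : v = 0 := h.inf_ker.le ⟨hv.1, hker v hv.2 hvQ⟩
        have h2 := hx.2
        rw [hv0, add_zero] at h2 ⊢
        exact hN.inf_eq_bot.le ⟨N.add_mem (hnN hq) hz, h2⟩
    refine ⟨N, hN, (EquivalentPairs.of_le hg ha he hmid (hlag N hN) ?_ le_sup_right).symm.trans
      (EquivalentPairs.of_le hg ha he hmid h inf_le_left le_sup_left)⟩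
    exact (inf_le_inf_right _ h.le).trans hnN
  obtain ⟨N₁, hN₁, hr₁⟩ := hred m₁ n₁ h₁
  obtain ⟨N₂, hN₂, hr₂⟩ := hred m₂ n₂ h₂
  exact (hr₁.symm.trans (hadj N₁ N₂ hN₁ hN₂)).trans hr₂

end Equivalence

/-- **Theorem 7.1 (Sadaka).** Let `Γ : 𝔤 = ⊕_{j∈ℚ} 𝔤_j` be an `e`-admissible grading with
`e ∈ 𝔤_a` such that `𝔤_{<0} = 𝔤_{≤−a} ⊕ (𝔤_{b−a} + 𝔤_{−b})` for some `b ∈ (0, a/2]`.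
Then all `e`-admissible pairs relative to `Γ` are pairwise equivalent. -/
theorem stmt_18 {L : Type*} [LieRing L] [LieAlgebra ℂ L]
    [FiniteDimensional ℂ L] [LieAlgebra.IsSimple ℂ L]
    (e : L) (he : IsNilpotent (ad ℂ L e))
    (g : ℚ → Submodule ℂ L) (hg : IsQGrading g)
    (a : ℤ) (ha : 1 < a) (hea : e ∈ g (a : ℚ))
    (hadm : ∃ m n : Submodule ℂ L, IsAdmissiblePairQ g e a m n)
    (b : ℚ) (hb : 0 < b) (hb2 : b ≤ (a : ℚ) / 2)
    (hdec : (⨆ j < (0:ℚ), g j) = (⨆ j ≤ -(a:ℚ), g j) ⊔ (g ((b : ℚ) - a) ⊔ g (-b))) :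
    ∀ m₁ n₁ m₂ n₂ : Submodule ℂ L,
      IsAdmissiblePairQ g e a m₁ n₁ → IsAdmissiblePairQ g e a m₂ n₂ →
      EquivalentPairs e (m₁, n₁) (m₂, n₂) := by
  intro m₁ n₁ m₂ n₂ h₁ h₂
  rcases hb2.lt_or_eq with hlt | heq
  · exact equivalentPairs_of_negPart_eq_sup_sup hg ha hea (c := b - a) (d := -b) (by ring)
      (by linarith) (by linarith) hdec h₁ h₂
  · have hba : b - a = -b := by linarith
    rw [hba, sup_idem] at hdec
    exact equivalentPairs_of_negPart_eq_sup hg ha hea (d := -b) (by linarith) (by linarith)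
      hdec h₁ h₂
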